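/- Let k ≥ 1, H₁, H₀ ∈ M_k(ℝ), and H(t) = tH₁ + H₀. If s, u ∈ ℝ are such that H(s) and H(u) are invertible, then for all t, v ∈ ℝ the matrices H(s)⁻¹H(t) and H(u)⁻¹H(v) commute. -/

import Mathlib

open Matrix

noncomputable section

/-- The nonsingular inverse of a unit commutes with everything the unit commutes with. -/
theorem commute_nonsing_inv_right {n R : Type*} [Fintype n] [DecidableEq n] [CommRing R]
    {A B : Matrix n n R} (hB : IsUnit B) (h : Commute A B) : Commute A B⁻¹ := by
  obtain ⟨U, rfl⟩ := hB
  rw [← Matrix.coe_units_inv]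
  exact h.units_inv_right

/-- For a matrix pencil H(t) = tH₁ + H₀, the matrices H(s)⁻¹H(t) and H(u)⁻¹H(v) commute. -/
theorem pencil_commute
    (k : ℕ) (hk : 1 ≤ k) (H₁ H₀ : Matrix (Fin k) (Fin k) ℝ)
    (H : ℝ → Matrix (Fin k) (Fin k) ℝ) (hH : ∀ t : ℝ, H t = t • H₁ + H₀)
    (s u : ℝ) (hs : IsUnit (H s)) (hu : IsUnit (H u)) :
    ∀ t v : ℝ,
      ((H s)⁻¹ * H t) * ((H u)⁻¹ * H v) = ((H u)⁻¹ * H v) * ((H s)⁻¹ * H t) := by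
  have hsd : IsUnit (H s).det := (Matrix.isUnit_iff_isUnit_det _).mp hs
  have hP (a : ℝ) : (H s)⁻¹ * H a = (a - s) • ((H s)⁻¹ * H₁) + 1 := by
    have ha : H a = (a - s) • H₁ + H s := by
      rw [hH a, hH s, sub_smul]
      abel
    rw [ha, mul_add, mul_smul_comm, Matrix.nonsing_inv_mul _ hsd]
  have hcomm (a b : ℝ) : Commute ((H s)⁻¹ * H a) ((H s)⁻¹ * H b) := by
    rw [hP a, hP b]
    exact (((Commute.refl _).smul_right _).smul_left _ |>.add_right (Commute.one_right _)).add_left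
      (Commute.one_left _)
  have hunit : IsUnit ((H s)⁻¹ * H u) := (Matrix.isUnit_nonsing_inv_iff.mpr hs).mul hu
  intro t v
  have huv : (H u)⁻¹ * H v = ((H s)⁻¹ * H u)⁻¹ * ((H s)⁻¹ * H v) := by
    rw [Matrix.mul_inv_rev, Matrix.nonsing_inv_nonsing_inv _ hsd, mul_assoc,
      Matrix.mul_nonsing_inv_cancel_left _ _ hsd]
  rw [huv]
  exact (commute_nonsing_inv_right hunit (hcomm t u)).mul_right (hcomm t v)

end
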